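/- Let D be an ℝ-graded vector space with a differential d_D of order [0,∞), and suppose D has gap [ε,2ε) for some ε > 0. Then: (a) d_D can be written as δ + (d_D − δ) with δ of order [0,ε) and d_D − δ of order [2ε,∞); (b) any such δ satisfies δ∘δ = 0; and (c) if in addition H(D,δ) = 0 for such a decomposition, then H(D,d_D) = 0. -/

import Mathlib

/-! Lemma 2.6.6 of Seidel, "A long exact sequence for symplectic Floer cohomology":
an ℝ-graded differential vector space over ℤ/2 with differential of order [0,∞) and
gap [ε,2ε) splits off a low-order differential δ, and acyclicity of δ implies
acyclicity of d. -/

/-- Support of an ℝ-grading by submodules. -/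
def GSupp {V : Type*} [AddCommGroup V] [Module (ZMod 2) V]
    (G : ℝ → Submodule (ZMod 2) V) : Set ℝ :=
  {r : ℝ | G r ≠ ⊥}

/-- The graded space has gap `I` if no two elements of the support differ by an
element of `I`. -/
def HasGap {V : Type*} [AddCommGroup V] [Module (ZMod 2) V]
    (G : ℝ → Submodule (ZMod 2) V) (I : Set ℝ) : Prop :=
  ∀ r ∈ GSupp G, ∀ s ∈ GSupp G, r - s ∉ I

/-- A linear map between ℝ-graded vector spaces is of order `I` if it maps the piece of
degree `r` into the sum of the pieces of degrees `s ∈ r + I`. -/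
def IsOrder {V W : Type*} [AddCommGroup V] [Module (ZMod 2) V]
    [AddCommGroup W] [Module (ZMod 2) W]
    (G : ℝ → Submodule (ZMod 2) V) (D : ℝ → Submodule (ZMod 2) W)
    (I : Set ℝ) (f : V →ₗ[ZMod 2] W) : Prop :=
  ∀ r : ℝ, ∀ x ∈ G r, f x ∈ ⨆ s ∈ {s : ℝ | s - r ∈ I}, D s

/-- (Co)homology of a differential: `ker d / im d`. -/
abbrev Homology {V : Type*} [AddCommGroup V] [Module (ZMod 2) V]
    (d : V →ₗ[ZMod 2] V) :=
  LinearMap.ker d ⧸ (LinearMap.range d).comap (LinearMap.ker d).subtype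

section GradedPart

variable {ι R M : Type*} [Ring R] [AddCommGroup M] [Module R M]
  {G : ι → Submodule R M}

/-- The sum of the graded pieces with degree in `S`. -/
def gradedPart (G : ι → Submodule R M) (S : Set ι) : Submodule R M :=
  ⨆ s ∈ S, G s

theorem le_gradedPart {S : Set ι} {r : ι} (hr : r ∈ S) : G r ≤ gradedPart G S :=
  le_iSup₂_of_le r hr le_rfl

theorem gradedPart_le {S : Set ι} {p : Submodule R M} (h : ∀ r ∈ S, G r ≤ p) :
    gradedPart G S ≤ p :=
  iSup₂_le h

/-- Only degrees with a nonzero graded piece contribute to `gradedPart`. -/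
theorem gradedPart_mono_of_ne_bot {S T : Set ι} (h : ∀ r ∈ S, G r ≠ ⊥ → r ∈ T) :
    gradedPart G S ≤ gradedPart G T := by
  refine gradedPart_le fun r hr => ?_
  by_cases h0 : G r = ⊥
  · simp [h0]
  · exact le_gradedPart (h r hr h0)

variable [DecidableEq ι]

theorem mem_gradedPart_univ (hG : DirectSum.IsInternal G) (x : M) :
    x ∈ gradedPart G Set.univ := by
  have h : gradedPart G Set.univ = ⊤ := by
    simpa [gradedPart] using hG.submodule_iSup_eq_top
  simp [h]

/-- The linear map that agrees with `φ r` on the graded piece of degree `r`. -/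
noncomputable def gradedLift (hG : DirectSum.IsInternal G) (φ : ι → M →ₗ[R] M) : M →ₗ[R] M :=
  DirectSum.toModule R ι M (fun r => φ r ∘ₗ (G r).subtype) ∘ₗ
    (LinearEquiv.ofBijective (DirectSum.coeLinearMap G) hG).symm.toLinearMap

theorem gradedLift_apply (hG : DirectSum.IsInternal G) (φ : ι → M →ₗ[R] M) {r : ι} {x : M}
    (hx : x ∈ G r) : gradedLift hG φ x = φ r x := by
  have h : (LinearEquiv.ofBijective (DirectSum.coeLinearMap G) hG).symm x =
      DirectSum.lof R ι (fun i => G i) r ⟨x, hx⟩ := by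
    rw [LinearEquiv.symm_apply_eq]
    exact (DirectSum.coeLinearMap_lof G r ⟨x, hx⟩).symm
  simp [gradedLift, h]

theorem linearMap_ext_of_graded (hG : DirectSum.IsInternal G) {f g : M →ₗ[R] M}
    (h : ∀ r, ∀ x ∈ G r, f x = g x) : f = g := by
  ext x
  have hle : gradedPart G Set.univ ≤ LinearMap.eqLocus f g :=
    gradedPart_le fun r _ x hx => h r x hx
  exact hle (mem_gradedPart_univ hG x)

open Classical in
/-- The projection onto the part with degrees in `S` along the part with degrees outside `S`. -/
noncomputable def gradedProj (hG : DirectSum.IsInternal G) (S : Set ι) : M →ₗ[R] M :=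
  gradedLift hG fun r => if r ∈ S then LinearMap.id else 0

theorem gradedProj_apply_of_mem (hG : DirectSum.IsInternal G) {S : Set ι} {x : M}
    (hx : x ∈ gradedPart G S) : gradedProj hG S x = x := by
  have hle : gradedPart G S ≤ LinearMap.eqLocus (gradedProj hG S) LinearMap.id :=
    gradedPart_le fun r hr y hy => by simp [gradedProj, gradedLift_apply hG _ hy, hr]
  exact hle hx

theorem gradedProj_apply_of_disjoint (hG : DirectSum.IsInternal G) {S T : Set ι}
    (hST : ∀ r ∈ T, r ∉ S) {x : M} (hx : x ∈ gradedPart G T) : gradedProj hG S x = 0 := by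
  have hle : gradedPart G T ≤ LinearMap.ker (gradedProj hG S) :=
    gradedPart_le fun r hr y hy => by simp [gradedProj, gradedLift_apply hG _ hy, hST r hr]
  exact hle hx

theorem gradedProj_mem (hG : DirectSum.IsInternal G) {S T : Set ι} {x : M}
    (hx : x ∈ gradedPart G T) : gradedProj hG S x ∈ gradedPart G (T ∩ S) := by
  have hle : gradedPart G T ≤ (gradedPart G (T ∩ S)).comap (gradedProj hG S) := by
    refine gradedPart_le fun r hr y hy => ?_
    by_cases h : r ∈ S
    · simpa [gradedProj, gradedLift_apply hG _ hy, h] using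
        le_gradedPart (S := T ∩ S) ⟨hr, h⟩ hy
    · simp [gradedProj, gradedLift_apply hG _ hy, h]
  exact hle hx

theorem sub_gradedProj_mem (hG : DirectSum.IsInternal G) {S T : Set ι} {x : M}
    (hx : x ∈ gradedPart G T) : x - gradedProj hG S x ∈ gradedPart G (T \ S) := by
  have hle : gradedPart G T ≤
      (gradedPart G (T \ S)).comap (LinearMap.id - gradedProj hG S) := by
    refine gradedPart_le fun r hr y hy => ?_
    by_cases h : r ∈ S
    · simp [gradedProj, gradedLift_apply hG _ hy, h]
    · simpa [gradedProj, gradedLift_apply hG _ hy, h] using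
        le_gradedPart (S := T \ S) ⟨hr, h⟩ hy
  exact hle hx

theorem eq_zero_of_mem_gradedPart_of_disjoint (hG : DirectSum.IsInternal G) {S T : Set ι}
    (hST : ∀ r ∈ T, r ∉ S) {x : M} (hS : x ∈ gradedPart G S) (hT : x ∈ gradedPart G T) :
    x = 0 := by
  rw [← gradedProj_apply_of_mem hG hS, gradedProj_apply_of_disjoint hG hST hT]

end GradedPart

theorem subsingleton_homology_iff {V : Type*} [AddCommGroup V] [Module (ZMod 2) V]
    (d : V →ₗ[ZMod 2] V) :
    Subsingleton (Homology d) ↔ ∀ x, d x = 0 → ∃ y, d y = x := by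
  rw [Submodule.Quotient.subsingleton_iff, Submodule.eq_top_iff']
  simp

section RealGraded

variable {V : Type*} [AddCommGroup V] [Module (ZMod 2) V] {G : ℝ → Submodule (ZMod 2) V}

theorem IsOrder.apply_mem {I S T : Set ℝ} {f : V →ₗ[ZMod 2] V} (hf : IsOrder G G I f)
    (h : ∀ r ∈ S, G r ≠ ⊥ → ∀ s, G s ≠ ⊥ → s - r ∈ I → s ∈ T) {x : V}
    (hx : x ∈ gradedPart G S) : f x ∈ gradedPart G T := by
  have hle : gradedPart G S ≤ (gradedPart G T).comap f := by
    refine gradedPart_le fun r hr y hy => ?_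
    by_cases h0 : G r = ⊥
    · rw [h0, Submodule.mem_bot] at hy
      simp [hy]
    · exact gradedPart_mono_of_ne_bot (fun s hs hs0 => h r hr h0 s hs0 hs) (hf r y hy)
  exact hle hx

/-- A map whose order `I` does not allow passing between `T` and its complement commutes with
the projection to `T`. -/
theorem IsOrder.gradedProj_comm (hG : DirectSum.IsInternal G) {I T : Set ℝ}
    {f : V →ₗ[ZMod 2] V} (hf : IsOrder G G I f)
    (h : ∀ r, G r ≠ ⊥ → ∀ s, G s ≠ ⊥ → s - r ∈ I → (r ∈ T ↔ s ∈ T)) (x : V) :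
    gradedProj hG T (f x) = f (gradedProj hG T x) := by
  have hcomm : gradedProj hG T ∘ₗ f = f ∘ₗ gradedProj hG T := by
    refine linearMap_ext_of_graded hG fun r x hx => ?_
    by_cases hr : r ∈ T
    · have hxT : x ∈ gradedPart G T := le_gradedPart hr hx
      have hfx : f x ∈ gradedPart G T :=
        hf.apply_mem (fun r hr hr0 s hs0 hs => (h r hr0 s hs0 hs).1 hr) hxT
      simp [gradedProj_apply_of_mem hG hxT, gradedProj_apply_of_mem hG hfx]
    · have hxT : x ∈ gradedPart G Tᶜ := le_gradedPart hr hx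
      have hfx : f x ∈ gradedPart G Tᶜ :=
        hf.apply_mem (S := Tᶜ)
          (fun r hr hr0 s hs0 hs hsT => hr ((h r hr0 s hs0 hs).2 hsT)) hxT
      simp [gradedProj_apply_of_disjoint hG (fun _ hr => hr) hxT,
        gradedProj_apply_of_disjoint hG (fun _ hr => hr) hfx]
  exact LinearMap.congr_fun hcomm x

theorem exists_low_order_part (hG : DirectSum.IsInternal G) {d : V →ₗ[ZMod 2] V}
    (hd : IsOrder G G (Set.Ici 0) d) {ε : ℝ} (hgap : HasGap G (Set.Ico ε (2 * ε))) :
    ∃ δ : V →ₗ[ZMod 2] V,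
      IsOrder G G (Set.Ico 0 ε) δ ∧ IsOrder G G (Set.Ici (2 * ε)) (d - δ) := by
  refine ⟨gradedLift hG fun r => gradedProj hG {s | s - r ∈ Set.Ico 0 ε} ∘ₗ d, ?_, ?_⟩
  · intro r x hx
    rw [gradedLift_apply hG _ hx]
    exact gradedPart_mono_of_ne_bot (fun s hs _ => hs.2)
      (gradedProj_mem hG (mem_gradedPart_univ hG (d x)))
  · intro r x hx
    by_cases h0 : G r = ⊥
    · rw [h0, Submodule.mem_bot] at hx
      simp [hx]
    rw [LinearMap.sub_apply, gradedLift_apply hG _ hx]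
    refine gradedPart_mono_of_ne_bot (fun s hs hs0 => ?_) (sub_gradedProj_mem hG (hd r x hx))
    have hs1 : 0 ≤ s - r := hs.1
    have hs2 : ε ≤ s - r := not_lt.1 fun h => hs.2 ⟨hs1, h⟩
    exact not_lt.1 fun h => hgap s hs0 r h0 ⟨hs2, h⟩

theorem low_order_part_comp_self (hG : DirectSum.IsInternal G) {d δ : V →ₗ[ZMod 2] V}
    (hdsq : d ∘ₗ d = 0) {ε : ℝ} (hε : 0 < ε) (hδ : IsOrder G G (Set.Ico 0 ε) δ)
    (hη : IsOrder G G (Set.Ici (2 * ε)) (d - δ)) : δ ∘ₗ δ = 0 := by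
  refine linearMap_ext_of_graded hG fun r x hx => ?_
  have hxr : x ∈ gradedPart G {r} := le_gradedPart (Set.mem_singleton r) hx
  have hδx : δ x ∈ gradedPart G (Set.Ico r (r + ε)) := hδ.apply_mem (by
    rintro _ rfl - s - ⟨h1, h2⟩
    exact ⟨by linarith, by linarith⟩) hxr
  have hηx : (d - δ) x ∈ gradedPart G (Set.Ici (r + 2 * ε)) := hη.apply_mem (by
    rintro _ rfl - s - h1
    simp only [Set.mem_Ici] at h1 ⊢
    linarith) hxr
  have hlow : δ (δ x) ∈ gradedPart G (Set.Ico r (r + 2 * ε)) := hδ.apply_mem (by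
    rintro t ⟨ht1, ht2⟩ - s - ⟨h1, h2⟩
    exact ⟨by linarith, by linarith⟩) hδx
  have hηδ : (d - δ) (δ x) ∈ gradedPart G (Set.Ici (r + 2 * ε)) := hη.apply_mem (by
    rintro t ⟨ht1, ht2⟩ - s - h1
    simp only [Set.mem_Ici] at h1 ⊢
    linarith) hδx
  have hδη : δ ((d - δ) x) ∈ gradedPart G (Set.Ici (r + 2 * ε)) := hδ.apply_mem (by
    rintro t ht - s - ⟨h1, h2⟩
    simp only [Set.mem_Ici] at ht ⊢
    linarith) hηx
  have hηη : (d - δ) ((d - δ) x) ∈ gradedPart G (Set.Ici (r + 2 * ε)) := hη.apply_mem (by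
    rintro t ht - s - h1
    simp only [Set.mem_Ici] at ht h1 ⊢
    linarith) hηx
  have hhigh : δ (δ x) ∈ gradedPart G (Set.Ici (r + 2 * ε)) := by
    have hsum : δ (δ x) =
        -((d - δ) (δ x) + δ ((d - δ) x) + (d - δ) ((d - δ) x)) := by
      have hddx : d (d x) = 0 := by
        rw [← LinearMap.comp_apply, hdsq, LinearMap.zero_apply]
      simp only [LinearMap.sub_apply, map_sub, hddx]
      abel
    rw [hsum]
    exact neg_mem (add_mem (add_mem hηδ hδη) hηη)
  rw [LinearMap.comp_apply, LinearMap.zero_apply]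
  refine eq_zero_of_mem_gradedPart_of_disjoint hG ?_ hlow hhigh
  exact fun s hs hs' => not_lt.2 (Set.mem_Ici.1 hs) hs'.2

/-- A level `c` cuts the grading if the degrees below and above it are at least `2ε` apart. -/
def IsCut (G : ℝ → Submodule (ZMod 2) V) (ε c : ℝ) : Prop :=
  ∀ r ∈ GSupp G, ∀ s ∈ GSupp G, r < c → c ≤ s → 2 * ε ≤ s - r

/-- If `a` is the lowest degree above the cut `c`, then `a + ε` is again a cut. -/
theorem IsCut.next {ε c a : ℝ} (hgap : HasGap G (Set.Ico ε (2 * ε)))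
    (hc : IsCut G ε c) (haG : a ∈ GSupp G) (hca : c ≤ a)
    (hmin : ∀ s ∈ GSupp G, c ≤ s → a ≤ s) (hε : 0 < ε) : IsCut G ε (a + ε) := by
  intro r hr s hs hra has
  by_cases hrc : r < c
  · exact hc r hr s hs hrc (by linarith)
  have har := hmin r hr (not_lt.1 hrc)
  have hsa : 2 * ε ≤ s - a := not_lt.1 fun h => hgap s hs a haG ⟨by linarith, h⟩
  exact not_lt.1 fun h => hgap s hs r hr ⟨by linarith, h⟩

theorem exists_eq_of_mem_gradedPart_Ici (hG : DirectSum.IsInternal G) (hfin : (GSupp G).Finite)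
    {d δ : V →ₗ[ZMod 2] V} (hdsq : d ∘ₗ d = 0) {ε : ℝ} (hε : 0 < ε)
    (hgap : HasGap G (Set.Ico ε (2 * ε))) (hδ : IsOrder G G (Set.Ico 0 ε) δ)
    (hη : IsOrder G G (Set.Ici (2 * ε)) (d - δ)) (hex : ∀ x, δ x = 0 → ∃ y, δ y = x)
    {c : ℝ} (hc : IsCut G ε c) {x : V} (hx : x ∈ gradedPart G (Set.Ici c)) (hdx : d x = 0) :
    ∃ y, d y = x := by
  induction hn : (GSupp G ∩ Set.Ici c).ncard using Nat.strong_induction_on generalizing c x with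
  | _ n ih =>
  have hfc : (GSupp G ∩ Set.Ici c).Finite := hfin.inter_of_left _
  rcases (GSupp G ∩ Set.Ici c).eq_empty_or_nonempty with hemp | hne
  · have hx0 : x ∈ gradedPart G (∅ : Set ℝ) :=
      gradedPart_mono_of_ne_bot (fun r hr hr0 => hemp.subset ⟨hr0, hr⟩) hx
    refine ⟨0, ?_⟩
    simpa [gradedPart, eq_comm] using hx0
  obtain ⟨a, ⟨haG, hca⟩, hmin'⟩ := Set.exists_min_image _ id hfc hne
  have hmin : ∀ s ∈ GSupp G, c ≤ s → a ≤ s := fun s hs hcs => hmin' s ⟨hs, hcs⟩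
  simp only [Set.mem_Ici] at hca
  have hc' : IsCut G ε (a + ε) := hc.next hgap haG hca hmin hε
  set P := gradedProj hG (Set.Ico c (a + ε)) with hP
  have hPδ : ∀ z, P (δ z) = δ (P z) := hδ.gradedProj_comm hG (by
    rintro r hr s hs ⟨h1, h2⟩
    refine ⟨fun h => ⟨by linarith [h.1], not_le.1 fun h' => ?_⟩,
      fun h => ⟨not_lt.1 fun h' => ?_, by linarith [h.2]⟩⟩
    · linarith [hc' r hr s hs h.2 h']
    · linarith [hc r hr s hs h' h.1])
  have hηIci : ∀ z ∈ gradedPart G (Set.Ici c),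
      (d - δ) z ∈ gradedPart G (Set.Ici (a + ε)) := fun z hz => hη.apply_mem (by
    intro r hr hr0 s _ h1
    have har := hmin r hr0 hr
    simp only [Set.mem_Ici] at h1 ⊢
    linarith) hz
  have hPx : δ (P x) = 0 := by
    have hδx : δ x = -(d - δ) x := by simp [hdx]
    rw [← hPδ, hδx]
    refine gradedProj_apply_of_disjoint hG ?_ (neg_mem (hηIci x hx))
    exact fun r hr hr' => not_lt.2 (Set.mem_Ici.1 hr) hr'.2
  obtain ⟨y, hy⟩ := hex _ hPx
  have hPy : δ (P y) = P x := by
    rw [← hPδ, hy]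
    exact gradedProj_apply_of_mem hG
      (gradedPart_mono_of_ne_bot (fun r hr _ => hr.2) (gradedProj_mem hG hx))
  have hPyc : P y ∈ gradedPart G (Set.Ici c) :=
    gradedPart_mono_of_ne_bot (fun r hr _ => hr.2.1)
      (gradedProj_mem hG (mem_gradedPart_univ hG y))
  have hrem : x - d (P y) ∈ gradedPart G (Set.Ici (a + ε)) := by
    have hsplit : x - d (P y) = (x - P x) - (d - δ) (P y) := by
      rw [LinearMap.sub_apply, hPy]
      abel
    rw [hsplit]
    refine sub_mem (gradedPart_mono_of_ne_bot (fun r hr _ => ?_) (sub_gradedProj_mem hG hx))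
      (hηIci _ hPyc)
    exact not_lt.1 fun h => hr.2 ⟨hr.1, h⟩
  have hlt : (GSupp G ∩ Set.Ici (a + ε)).ncard < n := by
    rw [← hn]
    refine Set.ncard_lt_ncard ⟨fun r hr => ⟨hr.1, ?_⟩, fun h => ?_⟩ hfc
    · have := hr.2
      simp only [Set.mem_Ici] at this ⊢
      linarith
    · have := (h ⟨haG, hca⟩).2
      simp only [Set.mem_Ici] at this
      linarith
  have hddy : d (d (P y)) = 0 := by
    rw [← LinearMap.comp_apply, hdsq, LinearMap.zero_apply]
  obtain ⟨z, hz⟩ := ih _ hlt hc' hrem (by simp [hdx, hddy]) rfl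
  exact ⟨z + P y, by simp [hz]⟩

end RealGraded

theorem gap_spectral_sequence
    {D : Type*} [AddCommGroup D] [Module (ZMod 2) D] [FiniteDimensional (ZMod 2) D]
    (G : ℝ → Submodule (ZMod 2) D)
    (hG : DirectSum.IsInternal G) (hfin : (GSupp G).Finite)
    (d : D →ₗ[ZMod 2] D) (hdsq : d ∘ₗ d = 0)
    (hdord : IsOrder G G (Set.Ici 0) d)
    (ε : ℝ) (hε : 0 < ε)
    (hgap : HasGap G (Set.Ico ε (2*ε))) :
    (∃ δ : D →ₗ[ZMod 2] D,
        IsOrder G G (Set.Ico 0 ε) δ ∧ IsOrder G G (Set.Ici (2*ε)) (d - δ)) ∧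
    (∀ δ : D →ₗ[ZMod 2] D,
        IsOrder G G (Set.Ico 0 ε) δ → IsOrder G G (Set.Ici (2*ε)) (d - δ) →
        δ ∘ₗ δ = 0 ∧ (Subsingleton (Homology δ) → Subsingleton (Homology d))) := by
  refine ⟨exists_low_order_part hG hdord hgap, fun δ hδ hη =>
    ⟨low_order_part_comp_self hG hdsq hε hδ hη, fun hH => ?_⟩⟩
  rw [subsingleton_homology_iff] at hH ⊢
  intro x hdx
  obtain ⟨c, hc⟩ := hfin.bddBelow
  refine exists_eq_of_mem_gradedPart_Ici hG hfin hdsq hε hgap hδ hη hH (c := c)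
    (fun r hr s _ hrc _ => absurd (hc hr) (not_le.2 hrc)) ?_ hdx
  exact gradedPart_mono_of_ne_bot (fun r _ hr => hc hr) (mem_gradedPart_univ hG x)
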